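/- Let (a,b,c;q) and (a′,b′,c′;q′) be elements of T-QRAC_red, and let (A, A*, A^ε) and (A′, A′*, A′^ε) denote the associated matrix triples. Then there exists an invertible S ∈ Mat_{d+1}(𝕂) with S^{−1}·A·S = A′, S^{−1}·A*·S = A′*, and S^{−1}·A^ε·S = A′^ε if and only if q′ = q, a′+a′^{−1} = a+a^{−1}, b′+b′^{−1} = b+b^{−1}, and c′+c′^{−1} = c+c^{−1}. -/

import Mathlib

/-- θ_i = a·q^{2i−d} + a^{−1}·q^{d−2i}. -/
noncomputable def qθ {K : Type*} [Field K] (d : ℕ) (a q : K) (i : ℕ) : K :=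
  a * q ^ (2 * (i : ℤ) - (d : ℤ)) + a⁻¹ * q ^ ((d : ℤ) - 2 * (i : ℤ))

/-- The first split sequence φ_i of QRacah type. -/
noncomputable def qφ {K : Type*} [Field K] (d : ℕ) (a b c q : K) (i : ℕ) : K :=
  a⁻¹ * b⁻¹ * q ^ ((d : ℤ) + 1) * (q ^ (i : ℤ) - q ^ (-(i : ℤ))) *
    (q ^ ((i : ℤ) - (d : ℤ) - 1) - q ^ ((d : ℤ) - (i : ℤ) + 1)) *
    (q ^ (-(i : ℤ)) - a * b * c * q ^ ((i : ℤ) - (d : ℤ) - 1)) *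
    (q ^ (-(i : ℤ)) - a * b * c⁻¹ * q ^ ((i : ℤ) - (d : ℤ) - 1))

/-- The second split sequence ϕ_i of QRacah type. -/
noncomputable def qϕ {K : Type*} [Field K] (d : ℕ) (a b c q : K) (i : ℕ) : K :=
  a * b⁻¹ * q ^ ((d : ℤ) + 1) * (q ^ (i : ℤ) - q ^ (-(i : ℤ))) *
    (q ^ ((i : ℤ) - (d : ℤ) - 1) - q ^ ((d : ℤ) - (i : ℤ) + 1)) *
    (q ^ (-(i : ℤ)) - a⁻¹ * b * c * q ^ ((i : ℤ) - (d : ℤ) - 1)) *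
    (q ^ (-(i : ℤ)) - a⁻¹ * b * c⁻¹ * q ^ ((i : ℤ) - (d : ℤ) - 1))

/-- Parameter array over 𝕂 of diameter d: conditions (PA1)–(PA5). -/
def IsParameterArray {K : Type*} [Field K] (d : ℕ) (θ θs φ ϕ : ℕ → K) : Prop :=
  (∀ i, i ≤ d → ∀ j, j ≤ d → i ≠ j → θ i ≠ θ j ∧ θs i ≠ θs j) ∧
  (∀ i, 1 ≤ i → i ≤ d → φ i ≠ 0 ∧ ϕ i ≠ 0) ∧
  (∀ i, 1 ≤ i → i ≤ d →
    φ i = ϕ 1 * (∑ h ∈ Finset.range i, (θ h - θ (d - h)) / (θ 0 - θ d)) +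
      (θs i - θs 0) * (θ (i - 1) - θ d)) ∧
  (∀ i, 1 ≤ i → i ≤ d →
    ϕ i = φ 1 * (∑ h ∈ Finset.range i, (θ h - θ (d - h)) / (θ 0 - θ d)) +
      (θs i - θs 0) * (θ (d - i + 1) - θ 0)) ∧
  (∃ β : K, ∀ i, 2 ≤ i → i + 1 ≤ d →
    (θ (i - 2) - θ (i + 1)) / (θ (i - 1) - θ i) = β ∧
    (θs (i - 2) - θs (i + 1)) / (θs (i - 1) - θs i) = β)

/-- The set QRAC_red: conditions (RQRAC1)–(RQRAC4). -/
def QRACred {K : Type*} [Field K] (d : ℕ) (a b c q : K) : Prop :=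
  (a ≠ 0 ∧ b ≠ 0 ∧ c ≠ 0 ∧ q ≠ 0) ∧
  (∀ i : ℕ, 1 ≤ i → i ≤ d → q ^ (2 * i) ≠ 1) ∧
  (∀ i : ℕ, 1 ≤ i → i ≤ 2 * d - 1 →
    a ^ 2 ≠ q ^ (2 * (d : ℤ) - 2 * (i : ℤ)) ∧ b ^ 2 ≠ q ^ (2 * (d : ℤ) - 2 * (i : ℤ))) ∧
  (∀ i : ℕ, 1 ≤ i → i ≤ d →
    a * b * c ≠ q ^ ((d : ℤ) - 2 * (i : ℤ) + 1) ∧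
    a⁻¹ * b * c ≠ q ^ ((d : ℤ) - 2 * (i : ℤ) + 1) ∧
    a * b⁻¹ * c ≠ q ^ ((d : ℤ) - 2 * (i : ℤ) + 1) ∧
    a * b * c⁻¹ ≠ q ^ ((d : ℤ) - 2 * (i : ℤ) + 1))

/-- The lower bidiagonal matrix A with A_{ii} = θ_i and A_{i,i−1} = 1. -/
noncomputable def matA {K : Type*} [Field K] (d : ℕ) (a q : K) :
    Matrix (Fin (d + 1)) (Fin (d + 1)) K :=
  Matrix.of fun i j =>
    if (i : ℕ) = (j : ℕ) then qθ d a q (i : ℕ)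
    else if (i : ℕ) = (j : ℕ) + 1 then 1 else 0

/-- The upper bidiagonal matrix A* with A*_{ii} = θ*_i and A*_{i−1,i} = φ_i. -/
noncomputable def matAs {K : Type*} [Field K] (d : ℕ) (a b c q : K) :
    Matrix (Fin (d + 1)) (Fin (d + 1)) K :=
  Matrix.of fun i j =>
    if (i : ℕ) = (j : ℕ) then qθ d b q (i : ℕ)
    else if (j : ℕ) = (i : ℕ) + 1 then qφ d a b c q (j : ℕ) else 0

/-- A^ε = (q^{−1}·A*A − q·AA*)/(q²−q^{−2})
      + ((a+a^{−1})(b+b^{−1}) + (c+c^{−1})(q^{d+1}+q^{−d−1}))/(q+q^{−1}) · I. -/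
noncomputable def matAe {K : Type*} [Field K] (d : ℕ) (a b c q : K) :
    Matrix (Fin (d + 1)) (Fin (d + 1)) K :=
  (q ^ 2 - q ^ (-2 : ℤ))⁻¹ •
      (q⁻¹ • (matAs d a b c q * matA d a q) - q • (matA d a q * matAs d a b c q)) +
    (((a + a⁻¹) * (b + b⁻¹) + (c + c⁻¹) * (q ^ ((d : ℤ) + 1) + q ^ (-(d : ℤ) - 1))) /
        (q + q⁻¹)) • (1 : Matrix (Fin (d + 1)) (Fin (d + 1)) K)

/-- The set T-QRAC_red: conditions (T-RQRAC1)–(T-RQRAC4). -/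
def TQRACred {K : Type*} [Field K] (d : ℕ) (a b c q : K) : Prop :=
  (a ≠ 0 ∧ b ≠ 0 ∧ c ≠ 0 ∧ q ≠ 0) ∧
  (∀ i : ℕ, 1 ≤ i → i ≤ d → q ^ (2 * i) ≠ 1) ∧
  (∀ i : ℕ, 1 ≤ i → i ≤ 2 * d - 1 →
    a ^ 2 ≠ q ^ (2 * (d : ℤ) - 2 * (i : ℤ)) ∧
    b ^ 2 ≠ q ^ (2 * (d : ℤ) - 2 * (i : ℤ)) ∧
    c ^ 2 ≠ q ^ (2 * (d : ℤ) - 2 * (i : ℤ))) ∧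
  (∀ i : ℕ, 1 ≤ i → i ≤ d →
    a * b * c ≠ q ^ ((d : ℤ) - 2 * (i : ℤ) + 1) ∧
    a⁻¹ * b * c ≠ q ^ ((d : ℤ) - 2 * (i : ℤ) + 1) ∧
    a * b⁻¹ * c ≠ q ^ ((d : ℤ) - 2 * (i : ℤ) + 1) ∧
    a * b * c⁻¹ ≠ q ^ ((d : ℤ) - 2 * (i : ℤ) + 1))

namespace QRacah

variable {K : Type*} [Field K]

/-- The eigenvalue sequence, extended to integer indices. -/
noncomputable def zθ (d : ℕ) (a q : K) (i : ℤ) : K :=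
  a * q ^ (2 * i - (d : ℤ)) + a⁻¹ * q ^ ((d : ℤ) - 2 * i)

/-- The first split sequence, extended to integer indices. -/
noncomputable def zφ (d : ℕ) (a b c q : K) (i : ℤ) : K :=
  a⁻¹ * b⁻¹ * q ^ ((d : ℤ) + 1) * (q ^ i - q ^ (-i)) *
    (q ^ (i - (d : ℤ) - 1) - q ^ ((d : ℤ) - i + 1)) *
    (q ^ (-i) - a * b * c * q ^ (i - (d : ℤ) - 1)) *
    (q ^ (-i) - a * b * c⁻¹ * q ^ (i - (d : ℤ) - 1))

lemma qθ_eq_zθ (d : ℕ) (a q : K) (i : ℕ) : qθ d a q i = zθ d a q i := rfl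

lemma qφ_eq_zφ (d : ℕ) (a b c q : K) (i : ℕ) : qφ d a b c q i = zφ d a b c q i := rfl

/-- The action of `matA` on sequences indexed by all integers. -/
noncomputable def opA (d : ℕ) (a q : K) (v : ℤ → K) : ℤ → K :=
  fun i => zθ d a q i * v i + v (i - 1)

/-- The action of `matAs` on sequences indexed by all integers. -/
noncomputable def opB (d : ℕ) (a b c q : K) (v : ℤ → K) : ℤ → K :=
  fun i => zθ d b q i * v i + zφ d a b c q (i + 1) * v (i + 1)

/-- The central element `(a + a⁻¹)(b + b⁻¹) + (c + c⁻¹)(q^{d+1} + q^{-d-1})`. -/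
noncomputable def central (d : ℕ) (a b c q : K) : K :=
  (a + a⁻¹) * (b + b⁻¹) + (c + c⁻¹) * (q ^ ((d : ℤ) + 1) + q ^ (-(d : ℤ) - 1))

set_option maxHeartbeats 4000000 in
lemma opA_opB_relation (d : ℕ) {a b c q : K} (ha : a ≠ 0) (hb : b ≠ 0) (hc : c ≠ 0) (hq : q ≠ 0)
    (v : ℤ → K) (i : ℤ) :
    opA d a q (opA d a q (opB d a b c q v)) i
      - (q ^ 2 + q⁻¹ ^ 2) * opA d a q (opB d a b c q (opA d a q v)) i
      + opB d a b c q (opA d a q (opA d a q v)) i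
      + (q ^ 2 - q⁻¹ ^ 2) ^ 2 * opB d a b c q v i =
    -((q - q⁻¹) ^ 2 * central d a b c q) * opA d a q v i
      + (q - q⁻¹) * (q ^ 2 - q⁻¹ ^ 2) * central d a c b q * v i := by
  have e1 : i - 1 + 1 = i := by ring
  have e2 : i + 1 - 1 = i := by ring
  have e3 : i - 1 - 1 + 1 = i - 1 := by ring
  simp only [opA, opB, e1, e2, e3]
  generalize v (i - 1 - 1) = x
  generalize v (i - 1) = y
  generalize v i = z
  generalize v (i + 1) = w
  simp only [zθ, zφ, central, mul_add, mul_sub, mul_one, zpow_add₀ hq, zpow_sub₀ hq, zpow_neg,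
    zpow_mul, zpow_natCast, zpow_ofNat, mul_comm (2 : ℤ) i]
  have hQ : q ^ i ≠ 0 := zpow_ne_zero _ hq
  have hD : q ^ d ≠ 0 := pow_ne_zero _ hq
  generalize q ^ i = Q at *
  generalize q ^ d = D at *
  field_simp
  ring

/-- Restriction of a sequence to the indices `0, …, d`. -/
def restr (d : ℕ) (v : ℤ → K) : Fin (d + 1) → K := fun i => v ((i : ℕ) : ℤ)

lemma matA_mulVec_restr (d : ℕ) (a q : K) {v : ℤ → K} (hv : ∀ i < 0, v i = 0) :
    (matA d a q).mulVec (restr d v) = restr d (opA d a q v) := by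
  funext i
  have hsum : (matA d a q).mulVec (restr d v) i =
      ∑ j ∈ Finset.range (d + 1), ((if (i : ℕ) = j then qθ d a q i * v j else 0) +
        (if (i : ℕ) = j + 1 then v j else 0)) := by
    rw [← Fin.sum_univ_eq_sum_range (fun j : ℕ =>
      (if (i : ℕ) = j then qθ d a q i * v j else 0) + (if (i : ℕ) = j + 1 then v j else 0))]
    rw [Matrix.mulVec, dotProduct]
    refine Finset.sum_congr rfl fun j _ => ?_
    simp only [matA, Matrix.of_apply, restr]
    split_ifs <;> first | omega | simp
  rw [hsum, Finset.sum_add_distrib, Finset.sum_ite_eq, if_pos (Finset.mem_range.2 i.2)]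
  simp only [restr, opA, qθ_eq_zθ]
  congr 1
  obtain ⟨i, hi⟩ := i
  cases i with
  | zero => simpa using (hv (-1) (by norm_num)).symm
  | succ k =>
    simp only [Nat.add_right_cancel_iff, Finset.sum_ite_eq, Finset.mem_range]
    rw [if_pos (by omega)]
    simp

lemma zφ_zero (d : ℕ) (a b c q : K) : zφ d a b c q 0 = 0 := by simp [zφ]

lemma zφ_diam_succ (d : ℕ) (a b c q : K) : zφ d a b c q (d + 1) = 0 := by simp [zφ]

lemma matAs_mulVec_restr (d : ℕ) (a b c q : K) (v : ℤ → K) :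
    (matAs d a b c q).mulVec (restr d v) = restr d (opB d a b c q v) := by
  funext i
  have hsum : (matAs d a b c q).mulVec (restr d v) i =
      ∑ j ∈ Finset.range (d + 1), ((if (i : ℕ) = j then qθ d b q i * v j else 0) +
        (if (i : ℕ) + 1 = j then qφ d a b c q j * v j else 0)) := by
    rw [← Fin.sum_univ_eq_sum_range (fun j : ℕ =>
      (if (i : ℕ) = j then qθ d b q i * v j else 0) +
        (if (i : ℕ) + 1 = j then qφ d a b c q j * v j else 0))]
    rw [Matrix.mulVec, dotProduct]
    refine Finset.sum_congr rfl fun j _ => ?_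
    simp only [matAs, Matrix.of_apply, restr]
    split_ifs <;> first | omega | simp
  rw [hsum, Finset.sum_add_distrib, Finset.sum_ite_eq, if_pos (Finset.mem_range.2 i.2),
    Finset.sum_ite_eq]
  simp only [restr, opB, qθ_eq_zθ, qφ_eq_zφ]
  congr 1
  split_ifs with h
  · push_cast; rfl
  · have : ((i : ℕ) : ℤ) = d := by
      have := i.2
      simp only [Finset.mem_range] at h
      omega
    rw [this, zφ_diam_succ, zero_mul]

lemma opA_of_neg (d : ℕ) (a q : K) {v : ℤ → K} (hv : ∀ i < 0, v i = 0) :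
    ∀ i < 0, opA d a q v i = 0 := by
  intro i hi
  simp [opA, hv i hi, hv (i - 1) (by omega)]

lemma opB_of_neg (d : ℕ) (a b c q : K) {v : ℤ → K} (hv : ∀ i < 0, v i = 0) :
    ∀ i < 0, opB d a b c q v i = 0 := by
  intro i hi
  rcases eq_or_ne i (-1) with rfl | h
  · simp [opB, hv (-1) hi, zφ_zero]
  · simp [opB, hv i hi, hv (i + 1) (by omega)]

/-- Extension of a vector by zero to all integer indices. -/
def extend (d : ℕ) (x : Fin (d + 1) → K) : ℤ → K :=
  fun i => if h : 0 ≤ i ∧ i ≤ d then x ⟨i.toNat, by omega⟩ else 0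

lemma extend_of_neg (d : ℕ) (x : Fin (d + 1) → K) : ∀ i < 0, extend d x i = 0 := by
  intro i hi
  exact dif_neg (by omega)

lemma extend_of_gt (d : ℕ) (x : Fin (d + 1) → K) {i : ℤ} (hi : (d : ℤ) < i) :
    extend d x i = 0 :=
  dif_neg (by omega)

lemma restr_extend (d : ℕ) (x : Fin (d + 1) → K) : restr d (extend d x) = x := by
  funext i
  have := i.2
  simp only [restr, extend]
  rw [dif_pos (by omega)]
  simp

lemma matA_matAs_relation (d : ℕ) {a b c q : K} (ha : a ≠ 0) (hb : b ≠ 0) (hc : c ≠ 0)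
    (hq : q ≠ 0) :
    matA d a q * matA d a q * matAs d a b c q
      - (q ^ 2 + q⁻¹ ^ 2) • (matA d a q * matAs d a b c q * matA d a q)
      + matAs d a b c q * matA d a q * matA d a q
      + (q ^ 2 - q⁻¹ ^ 2) ^ 2 • matAs d a b c q =
    (-((q - q⁻¹) ^ 2 * central d a b c q)) • matA d a q
      + ((q - q⁻¹) * (q ^ 2 - q⁻¹ ^ 2) * central d a c b q) • 1 := by
  rw [Matrix.ext_iff_mulVec]
  intro x
  rw [← restr_extend d x]
  have h0 := extend_of_neg d x
  generalize extend d x = v at *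
  simp only [Matrix.add_mulVec, Matrix.sub_mulVec, Matrix.smul_mulVec, Matrix.one_mulVec,
    ← Matrix.mulVec_mulVec]
  have hA := opA_of_neg d a q h0
  have hB := opB_of_neg d a b c q h0
  rw [matAs_mulVec_restr, matA_mulVec_restr _ _ _ hB, matA_mulVec_restr _ _ _ h0,
    matAs_mulVec_restr, matA_mulVec_restr _ _ _ (opA_of_neg d a q hB),
    matA_mulVec_restr _ _ _ (opB_of_neg d a b c q hA), matA_mulVec_restr _ _ _ hA,
    matAs_mulVec_restr]
  funext i
  exact opA_opB_relation d ha hb hc hq v i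

/-- The standard basis vectors, equal to zero beyond the last index. -/
def basisVec (K : Type*) [Field K] (d n : ℕ) : Fin (d + 1) → K :=
  fun j => if (j : ℕ) = n then 1 else 0

lemma basisVec_eq_restr (d n : ℕ) :
    basisVec K d n = restr d (fun i => if i = (n : ℤ) then 1 else 0) := by
  funext i
  simp [basisVec, restr]

lemma basisVec_eq_zero {d n : ℕ} (h : d < n) : basisVec K d n = 0 := by
  funext i
  have := i.2
  simp only [basisVec, Pi.zero_apply]
  exact if_neg (by omega)

lemma basisVec_fin (d : ℕ) (i : Fin (d + 1)) : basisVec K d i = Pi.single i 1 := by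
  funext j
  simp [basisVec, Pi.single_apply, Fin.ext_iff]

lemma matrix_ext_basisVec {d : ℕ} {M N : Matrix (Fin (d + 1)) (Fin (d + 1)) K}
    (h : ∀ n ≤ d, M.mulVec (basisVec K d n) = N.mulVec (basisVec K d n)) : M = N := by
  refine Matrix.ext_of_mulVec_single fun i => ?_
  rw [← basisVec_fin]
  exact h i (by omega)

lemma matA_mulVec_basisVec (d : ℕ) (a q : K) (n : ℕ) :
    (matA d a q).mulVec (basisVec K d n) =
      zθ d a q n • basisVec K d n + basisVec K d (n + 1) := by
  rw [basisVec_eq_restr, matA_mulVec_restr _ _ _ (fun i hi => if_neg (by omega)),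
    basisVec_eq_restr]
  funext i
  have h : (((i : ℕ) : ℤ) - 1 = n) ↔ (i : ℕ) = n + 1 := by omega
  by_cases hi : (i : ℕ) = n
  · simp [restr, opA, hi]
  · simp [restr, opA, h, hi]
    norm_cast

lemma matAs_mulVec_basisVec_zero (d : ℕ) (a b c q : K) :
    (matAs d a b c q).mulVec (basisVec K d 0) = zθ d b q 0 • basisVec K d 0 := by
  rw [basisVec_eq_restr, matAs_mulVec_restr]
  funext i
  have h : ((i : ℕ) : ℤ) + 1 ≠ 0 := by omega
  by_cases hi : i = 0 <;> simp [restr, opB, h, hi]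

lemma matAs_mulVec_basisVec_succ (d : ℕ) (a b c q : K) (n : ℕ) :
    (matAs d a b c q).mulVec (basisVec K d (n + 1)) =
      zθ d b q (n + 1) • basisVec K d (n + 1) + zφ d a b c q (n + 1) • basisVec K d n := by
  rw [basisVec_eq_restr, matAs_mulVec_restr, basisVec_eq_restr]
  funext i
  simp only [restr, opB, Pi.add_apply, Pi.smul_apply, smul_eq_mul]
  push_cast
  congr 1
  · split_ifs with h <;> simp [h]
  · by_cases h : ((i : ℕ) : ℤ) = n <;> simp [h]

/-- Simultaneous conjugacy of two pairs of matrices. -/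
def SimConj {n : ℕ} (A B A' B' : Matrix (Fin n) (Fin n) K) : Prop :=
  ∃ S : Matrix (Fin n) (Fin n) K, IsUnit S ∧ A * S = S * A' ∧ B * S = S * B'

lemma SimConj.trans {n : ℕ} {A B A' B' A'' B'' : Matrix (Fin n) (Fin n) K}
    (h : SimConj A B A' B') (h' : SimConj A' B' A'' B'') : SimConj A B A'' B'' := by
  obtain ⟨S, hS, hA, hB⟩ := h
  obtain ⟨T, hT, hA', hB'⟩ := h'
  exact ⟨S * T, hS.mul hT, by rw [← mul_assoc, hA, mul_assoc, hA', mul_assoc],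
    by rw [← mul_assoc, hB, mul_assoc, hB', mul_assoc]⟩

lemma SimConj.symm {n : ℕ} {A B A' B' : Matrix (Fin n) (Fin n) K}
    (h : SimConj A B A' B') : SimConj A' B' A B := by
  obtain ⟨_, ⟨u, rfl⟩, hA, hB⟩ := h
  exact ⟨↑u⁻¹, u⁻¹.isUnit, by rw [Units.eq_inv_mul_iff_mul_eq, ← mul_assoc, ← hA]; simp [mul_assoc],
    by rw [Units.eq_inv_mul_iff_mul_eq, ← mul_assoc, ← hB]; simp [mul_assoc]⟩

lemma SimConj.swap {n : ℕ} {A B A' B' : Matrix (Fin n) (Fin n) K}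
    (h : SimConj A B A' B') : SimConj B A B' A' := by
  obtain ⟨S, hS, hA, hB⟩ := h
  exact ⟨S, hS, hB, hA⟩

lemma zθ_inv (d : ℕ) (a q : K) (i : ℤ) : zθ d a⁻¹ q i = zθ d a q (d - i) := by
  simp only [zθ, inv_inv]
  rw [add_comm]
  congr 3 <;> ring

lemma central_inv_left (d : ℕ) (a b c q : K) : central d a⁻¹ b c q = central d a b c q := by
  simp only [central, inv_inv]
  ring

lemma iterate_sub_smul {n : ℕ} (A : Matrix (Fin n) (Fin n) K) (t : ℕ → K) (u : ℕ → Fin n → K)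
    (m : ℕ) (h : ∀ k < m, u (k + 1) = A.mulVec (u k) - t k • u k) :
    u m = (Polynomial.aeval A (∏ k ∈ Finset.range m,
      (Polynomial.X - Polynomial.C (t k)))).mulVec (u 0) := by
  induction m with
  | zero => simp
  | succ m ih =>
    rw [h m (by omega), Finset.prod_range_succ, mul_comm, map_mul, ← Matrix.mulVec_mulVec,
      ← ih fun k hk => h k (by omega)]
    simp [Matrix.sub_mulVec, Algebra.algebraMap_eq_smul_one, Matrix.smul_mulVec]

/-- The vectors `(A - θ_{d-n+1}) ⋯ (A - θ_d) e_0`. -/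
noncomputable def flipVec (d : ℕ) (a q : K) : ℕ → Fin (d + 1) → K
  | 0 => basisVec K d 0
  | n + 1 => (matA d a q).mulVec (flipVec d a q n) - zθ d a⁻¹ q n • flipVec d a q n

lemma flipVec_diam_succ (d : ℕ) (a q : K) : flipVec d a q (d + 1) = 0 := by
  rw [iterate_sub_smul (matA d a q) (fun n => zθ d a⁻¹ q n) (flipVec d a q) (d + 1)
    (fun k _ => rfl)]
  have h := iterate_sub_smul (matA d a q) (fun n => zθ d a q n) (basisVec K d) (d + 1)
    (fun k _ => by rw [matA_mulVec_basisVec]; simp)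
  rw [basisVec_eq_zero (Nat.lt_succ_self d)] at h
  rw [← Finset.prod_range_reflect] at h
  rw [flipVec, h]
  congr 2
  refine Finset.prod_congr rfl fun k hk => ?_
  rw [zθ_inv]
  congr 3
  simp only [Finset.mem_range] at hk
  omega

lemma flipVec_apply (d : ℕ) (a q : K) (n : ℕ) (hn : n ≤ d) :
    (∀ j : Fin (d + 1), n < (j : ℕ) → flipVec d a q n j = 0) ∧
      flipVec d a q n ⟨n, by omega⟩ = 1 := by
  induction n with
  | zero =>
    refine ⟨fun j hj => ?_, by simp [flipVec, basisVec]⟩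
    simp [flipVec, basisVec, hj.ne']
  | succ n ih =>
    obtain ⟨h1, h2⟩ := ih (by omega)
    have key : ∀ j : Fin (d + 1), n < (j : ℕ) →
        flipVec d a q (n + 1) j = extend d (flipVec d a q n) ((j : ℕ) - 1) := by
      intro j hj
      have hr : flipVec d a q n j = extend d (flipVec d a q n) ((j : ℕ) : ℤ) :=
        (congrFun (restr_extend d (flipVec d a q n)) j).symm
      have hA : (matA d a q).mulVec (flipVec d a q n) j =
          opA d a q (extend d (flipVec d a q n)) ((j : ℕ) : ℤ) := by
        conv_lhs => rw [← restr_extend d (flipVec d a q n)]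
        rw [matA_mulVec_restr _ _ _ (extend_of_neg d _)]
        rfl
      simp [flipVec, hA, opA, ← hr, h1 j hj]
    have hext : ∀ m : ℕ, (hm : m ≤ d) → extend d (flipVec d a q n) m =
        flipVec d a q n ⟨m, by omega⟩ := fun m hm =>
      congrFun (restr_extend d (flipVec d a q n)) ⟨m, by omega⟩
    constructor
    · intro j hj
      rw [key j (by omega)]
      have : (((j : ℕ) : ℤ) - 1) = ((j - 1 : ℕ) : ℤ) := by omega
      rw [this, hext _ (by omega)]
      exact h1 _ (by simp only; omega)
    · rw [key _ (by simp)]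
      have : (((n + 1 : ℕ) : ℤ) - 1) = (n : ℤ) := by omega
      simp only [this]
      rw [hext _ (by omega), h2]

/-- The transition matrix with columns `flipVec`. -/
noncomputable def flipMat (d : ℕ) (a q : K) : Matrix (Fin (d + 1)) (Fin (d + 1)) K :=
  Matrix.of fun j i => flipVec d a q i j

lemma flipMat_mulVec (d : ℕ) (a q : K) (n : ℕ) (hn : n ≤ d + 1) :
    (flipMat d a q).mulVec (basisVec K d n) = flipVec d a q n := by
  rcases Nat.lt_or_ge n (d + 1) with h | h
  · have := basisVec_fin (K := K) d ⟨n, h⟩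
    simp only at this
    rw [this, Matrix.mulVec_single_one]
    rfl
  · obtain rfl : n = d + 1 := le_antisymm hn h
    rw [basisVec_eq_zero (by omega), flipVec_diam_succ, Matrix.mulVec_zero]

lemma isUnit_flipMat (d : ℕ) (a q : K) : IsUnit (flipMat d a q) := by
  rw [Matrix.isUnit_iff_isUnit_det, Matrix.det_of_isUpperTriangular]
  · rw [Finset.prod_eq_one]
    · exact isUnit_one
    · intro i _
      exact (flipVec_apply d a q i (by omega)).2
  · intro i j hij
    exact (flipVec_apply d a q j (by omega)).1 i hij

lemma matA_mul_flipMat (d : ℕ) (a q : K) :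
    matA d a q * flipMat d a q = flipMat d a q * matA d a⁻¹ q := by
  refine matrix_ext_basisVec fun n hn => ?_
  rw [← Matrix.mulVec_mulVec, ← Matrix.mulVec_mulVec, matA_mulVec_basisVec, Matrix.mulVec_add,
    Matrix.mulVec_smul, flipMat_mulVec _ _ _ _ (by omega), flipMat_mulVec _ _ _ _ (by omega)]
  simp [flipVec]

lemma zφ_inv_left_one (d : ℕ) {a b c q : K} (ha : a ≠ 0) (hb : b ≠ 0) (hc : c ≠ 0) (hq : q ≠ 0) :
    zφ d a⁻¹ b c q 1 =
      zφ d a b c q 1 + (zθ d a q 0 - zθ d a⁻¹ q 0) * (zθ d b q 0 - zθ d b q 1) := by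
  simp only [zθ, zφ, mul_add, mul_sub, mul_one, zpow_add₀ hq, zpow_sub₀ hq, zpow_neg,
    zpow_natCast, zpow_ofNat, mul_zero, inv_inv]
  have hD : q ^ d ≠ 0 := pow_ne_zero _ hq
  generalize q ^ d = D at *
  field_simp
  ring

theorem simConj_inv_left (d : ℕ) (hd : 1 ≤ d) {a b c q : K} (ha : a ≠ 0) (hb : b ≠ 0)
    (hc : c ≠ 0) (hq : q ≠ 0) :
    SimConj (matA d a q) (matAs d a b c q) (matA d a⁻¹ q) (matAs d a⁻¹ b c q) := by
  refine ⟨flipMat d a q, isUnit_flipMat d a q, matA_mul_flipMat d a q, ?_⟩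
  have hS := matA_mul_flipMat d a q
  have hSm : ∀ n ≤ d + 1, (flipMat d a q).mulVec (basisVec K d n) = flipVec d a q n :=
    fun n hn => flipMat_mulVec d a q n hn
  have R := matA_matAs_relation d ha hb hc hq
  have R' := matA_matAs_relation d (inv_ne_zero ha) hb hc hq
  rw [central_inv_left, show central d a⁻¹ c b q = central d a c b q from central_inv_left ..]
    at R'
  have hA' := matA_mulVec_basisVec d a⁻¹ q
  have hB0 := matAs_mulVec_basisVec_zero d a b c q
  have hB1 := matAs_mulVec_basisVec_succ d a b c q 0
  have hB0' := matAs_mulVec_basisVec_zero d a⁻¹ b c q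
  have hB1' := matAs_mulVec_basisVec_succ d a⁻¹ b c q 0
  have hA0 := matA_mulVec_basisVec d a q 0
  have hφ := zφ_inv_left_one d ha hb hc hq
  generalize q ^ 2 + q⁻¹ ^ 2 = β at *
  generalize (q ^ 2 - q⁻¹ ^ 2) ^ 2 = ρ at *
  generalize hDdef : matAs d a b c q * flipMat d a q - flipMat d a q * matAs d a⁻¹ b c q = D
  have hv0 : flipVec d a q 0 = basisVec K d 0 := rfl
  have hv1 : flipVec d a q 1 =
      (zθ d a q 0 - zθ d a⁻¹ q 0) • basisVec K d 0 + basisVec K d 1 := by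
    rw [flipVec, hv0, hA0]
    push_cast
    module
  have hD0 : D.mulVec (basisVec K d 0) = 0 := by
    rw [← hDdef, Matrix.sub_mulVec, ← Matrix.mulVec_mulVec, ← Matrix.mulVec_mulVec,
      hSm 0 (by omega), hB0', Matrix.mulVec_smul, hSm 0 (by omega), hv0, hB0, sub_self]
  have hD1 : D.mulVec (basisVec K d 1) = 0 := by
    simp only [zero_add, Nat.cast_zero] at hB1 hB1'
    rw [← hDdef, Matrix.sub_mulVec, ← Matrix.mulVec_mulVec, ← Matrix.mulVec_mulVec,
      hSm 1 (by omega), hB1', Matrix.mulVec_add, Matrix.mulVec_smul, Matrix.mulVec_smul,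
      hSm 0 (by omega), hSm 1 (by omega), hv0, hv1, Matrix.mulVec_add, Matrix.mulVec_smul,
      hB0, hB1, hφ]
    module
  generalize matAs d a b c q = B at *
  generalize matAs d a⁻¹ b c q = B' at *
  generalize flipMat d a q = S at *
  generalize matA d a q = A at *
  generalize matA d a⁻¹ q = A' at *
  have hS2 : ∀ X, A * (S * X) = S * (A' * X) := fun X => by
    rw [← mul_assoc, hS, mul_assoc]
  have hDrel : A * A * D - β • (A * D * A') + D * A' * A' + ρ • D = 0 := by
    have h1 := congrArg (· * S) R
    have h2 := congrArg (S * ·) R'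
    have h3 := congrArg₂ (· - ·) h1 h2
    simp only [add_mul, sub_mul, mul_add, mul_sub, Matrix.smul_mul, Matrix.mul_smul, mul_assoc,
      hS, hS2, one_mul, mul_one, sub_self] at h3
    rw [← hDdef]
    simp only [mul_sub, sub_mul, mul_assoc, hS2, smul_sub]
    rw [← h3]
    abel
  have hD : ∀ n, n + 1 ≤ d → D.mulVec (basisVec K d n) = 0 ∧
      D.mulVec (basisVec K d (n + 1)) = 0 := by
    intro n
    induction n with
    | zero => exact fun _ => ⟨hD0, hD1⟩
    | succ n ih =>
      intro hn
      obtain ⟨i1, i2⟩ := ih (by omega)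
      refine ⟨i2, ?_⟩
      have h := congrArg (·.mulVec (basisVec K d n)) hDrel
      simpa [Matrix.add_mulVec, Matrix.sub_mulVec, Matrix.smul_mulVec, ← Matrix.mulVec_mulVec,
        hA', Matrix.mulVec_add, Matrix.mulVec_smul, i1, i2] using h
  refine sub_eq_zero.1 (hDdef.trans (matrix_ext_basisVec fun n hn => ?_))
  rw [Matrix.zero_mulVec]
  cases n with
  | zero => exact hD0
  | succ n => exact (hD n hn).2

lemma _root_.TQRACred.inv_left {d : ℕ} {a b c q : K} (h : TQRACred d a b c q) :
    TQRACred d a⁻¹ b c q := by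
  obtain ⟨⟨ha, hb, hc, hq⟩, h2, h3, h4⟩ := h
  have flip : ∀ (x : K) (n : ℤ), x ≠ q ^ n → x⁻¹ ≠ q ^ (-n) := fun x n hx h => hx (by
    rw [zpow_neg] at h
    exact inv_injective h)
  refine ⟨⟨inv_ne_zero ha, hb, hc, hq⟩, h2, fun i hi hi' => ⟨?_, (h3 i hi hi').2⟩,
    fun i hi hi' => ?_⟩
  · have := flip _ _ (h3 (2 * d - i) (by omega) (by omega)).1
    rw [inv_pow]
    convert this using 2
    rw [Nat.cast_sub (by omega)]
    push_cast
    ring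
  · obtain ⟨e1, e2, e3, e4⟩ := h4 i hi hi'
    obtain ⟨f1, f2, f3, f4⟩ := h4 (d + 1 - i) (by omega) (by omega)
    have hn : -((d : ℤ) - 2 * ((d + 1 - i : ℕ) : ℤ) + 1) = d - 2 * i + 1 := by
      rw [Nat.cast_sub (by omega)]
      push_cast
      ring
    have f3' := flip _ _ f3
    have f4' := flip _ _ f4
    rw [hn] at f3' f4'
    refine ⟨e2, by rwa [inv_inv], ?_, ?_⟩
    · convert f4' using 1
      simp only [mul_inv, inv_inv]
    · convert f3' using 1
      simp only [mul_inv, inv_inv]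

lemma _root_.TQRACred.swap {d : ℕ} {a b c q : K} (h : TQRACred d a b c q) :
    TQRACred d b a c q := by
  obtain ⟨⟨ha, hb, hc, hq⟩, h2, h3, h4⟩ := h
  refine ⟨⟨hb, ha, hc, hq⟩, h2, fun i hi hi' => ?_, fun i hi hi' => ?_⟩
  · obtain ⟨e1, e2, e3⟩ := h3 i hi hi'
    exact ⟨e2, e1, e3⟩
  · obtain ⟨e1, e2, e3, e4⟩ := h4 i hi hi'
    rw [mul_comm b a, mul_comm b⁻¹ a, mul_comm b a⁻¹]
    exact ⟨e1, e3, e2, e4⟩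

lemma _root_.TQRACred.inv_middle {d : ℕ} {a b c q : K} (h : TQRACred d a b c q) :
    TQRACred d a b⁻¹ c q :=
  h.swap.inv_left.swap

lemma _root_.TQRACred.zpow_sub_ne {d : ℕ} {a b c q : K} (h : TQRACred d a b c q) {i : ℤ}
    (hi : 1 ≤ i) (hi' : i ≤ d) : q ^ i - q ^ (-i) ≠ 0 := by
  obtain ⟨⟨-, -, -, hq⟩, h2, -⟩ := h
  lift i to ℕ using by omega
  intro h0
  refine h2 i (by omega) (by omega) ?_
  rw [sub_eq_zero, zpow_neg, zpow_natCast] at h0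
  rw [two_mul, pow_add]
  nth_rewrite 2 [h0]
  exact mul_inv_cancel₀ (pow_ne_zero _ hq)

lemma _root_.TQRACred.zφ_ne_zero {d : ℕ} {a b c q : K} (h : TQRACred d a b c q) {i : ℤ}
    (hi : 1 ≤ i) (hi' : i ≤ d) : zφ d a b c q i ≠ 0 := by
  have hs := h.zpow_sub_ne hi hi'
  have hs' := h.zpow_sub_ne (i := d - i + 1) (by omega) (by omega)
  obtain ⟨⟨ha, hb, hc, hq⟩, -, -, h4⟩ := h
  have key : ∀ x : K, x ≠ q ^ ((d : ℤ) - 2 * i + 1) → q ^ (-i) - x * q ^ (i - (d : ℤ) - 1) ≠ 0 := by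
    intro x hx h0
    apply hx
    rw [sub_eq_zero, ← div_eq_iff (zpow_ne_zero _ hq), ← zpow_sub₀ hq] at h0
    rw [← h0]
    congr 1
    ring
  have e : i - (d : ℤ) - 1 = -((d : ℤ) - i + 1) := by ring
  obtain ⟨e1, -, -, e4⟩ := h4 i.toNat (by omega) (by omega)
  rw [Int.toNat_of_nonneg (by omega)] at e1 e4
  refine mul_ne_zero (mul_ne_zero (mul_ne_zero (mul_ne_zero (mul_ne_zero (mul_ne_zero
    (inv_ne_zero ha) (inv_ne_zero hb)) (zpow_ne_zero _ hq)) hs) ?_) (key _ e1)) (key _ e4)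
  rw [e, ← neg_sub]
  exact neg_ne_zero.2 hs'

lemma zφ_reverse (d : ℕ) {a b c q : K} (ha : a ≠ 0) (hb : b ≠ 0) (hc : c ≠ 0) (hq : q ≠ 0)
    (i : ℤ) : zφ d b⁻¹ a⁻¹ c q i = zφ d a b c q (d + 1 - i) := by
  simp only [zφ, zpow_add₀ hq, zpow_sub₀ hq, zpow_neg, zpow_natCast, zpow_one, inv_inv]
  have hQ : q ^ i ≠ 0 := zpow_ne_zero _ hq
  have hD : q ^ d ≠ 0 := pow_ne_zero _ hq
  generalize q ^ i = Q at *
  generalize q ^ d = D at *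
  field_simp
  ring

/-- Interchanging the two matrices amounts to replacing `(a, b, c)` by `(b⁻¹, a⁻¹, c)`. -/
theorem simConj_interchange {d : ℕ} {a b c q : K} (h : TQRACred d a b c q) :
    SimConj (matA d a q) (matAs d a b c q) (matAs d b⁻¹ a⁻¹ c q) (matA d b⁻¹ q) := by
  obtain ⟨s, hs⟩ : ∃ s : ℕ → K, s = fun n => ∏ k ∈ Finset.range n, zφ d a b c q (d - k) :=
    ⟨_, rfl⟩
  have hsucc : ∀ n, s (n + 1) = s n * zφ d a b c q (d - n) := fun n => by
    rw [hs]
    exact Finset.prod_range_succ ..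
  have hs0 : ∀ n, n ≤ d → s n ≠ 0 := by
    intro n hn
    rw [hs, Finset.prod_ne_zero_iff]
    intro k hk
    have := Finset.mem_range.1 hk
    exact h.zφ_ne_zero (by omega) (by omega)
  obtain ⟨⟨ha, hb, hc, hq⟩, -⟩ := h
  obtain ⟨S, hSdef⟩ : ∃ S : Matrix (Fin (d + 1)) (Fin (d + 1)) K,
    S = (Matrix.diagonal fun i : Fin (d + 1) => s i).submatrix Fin.revPerm (Equiv.refl _) :=
    ⟨_, rfl⟩
  have hS : ∀ n ≤ d, S.mulVec (basisVec K d n) = s n • basisVec K d (d - n) := by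
    intro n hn
    have := basisVec_fin (K := K) d ⟨n, by omega⟩
    simp only at this
    rw [this, Matrix.mulVec_single_one, hSdef]
    funext j
    have hj : Fin.rev j = ⟨n, by omega⟩ ↔ (j : ℕ) = d - n := by
      rw [Fin.ext_iff, Fin.val_rev]
      simp only
      omega
    by_cases hjn : (j : ℕ) = d - n
    · simp [basisVec, hjn, hj.2 hjn]
    · simp [basisVec, hj, hjn]
  refine ⟨S, ?_, ?_, ?_⟩
  · rw [hSdef, Matrix.isUnit_submatrix_equiv, Matrix.isUnit_diagonal, Pi.isUnit_iff]
    exact fun i => (hs0 i (by omega)).isUnit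
  · refine matrix_ext_basisVec fun n hn => ?_
    rw [← Matrix.mulVec_mulVec, ← Matrix.mulVec_mulVec, hS n hn, Matrix.mulVec_smul,
      matA_mulVec_basisVec]
    cases n with
    | zero =>
      rw [matAs_mulVec_basisVec_zero, Matrix.mulVec_smul, hS 0 hn, zθ_inv,
        Nat.sub_zero, basisVec_eq_zero (Nat.lt_succ_self d), add_zero, sub_zero]
      module
    | succ n =>
      rw [matAs_mulVec_basisVec_succ, Matrix.mulVec_add, Matrix.mulVec_smul, Matrix.mulVec_smul,
        hS _ hn, hS n (by omega), zθ_inv, zφ_reverse d ha hb hc hq,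
        show d - (n + 1) + 1 = d - n by omega, hsucc,
        show (d : ℤ) + 1 - (n + 1) = d - n by ring,
        show (((d - (n + 1) : ℕ)) : ℤ) = d - (n + 1) by omega]
      module
  · refine matrix_ext_basisVec fun n hn => ?_
    rw [← Matrix.mulVec_mulVec, ← Matrix.mulVec_mulVec, hS n hn, Matrix.mulVec_smul,
      matA_mulVec_basisVec, Matrix.mulVec_add, Matrix.mulVec_smul, hS n hn, zθ_inv]
    rcases Nat.lt_or_ge n d with hnd | hnd
    · obtain ⟨m, hm⟩ : ∃ m, d - n = m + 1 := ⟨d - n - 1, by omega⟩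
      have hm' : (d : ℤ) - n = m + 1 := by omega
      rw [hS (n + 1) (by omega), hm, matAs_mulVec_basisVec_succ,
        show d - (n + 1) = m by omega, hsucc, hm']
      module
    · obtain rfl : n = d := le_antisymm hn hnd
      rw [Nat.sub_self, matAs_mulVec_basisVec_zero, basisVec_eq_zero (Nat.lt_succ_self n),
        Matrix.mulVec_zero, add_zero, sub_self]
      module

theorem simConj_inv_middle {d : ℕ} (hd : 1 ≤ d) {a b c q : K} (h : TQRACred d a b c q) :
    SimConj (matA d a q) (matAs d a b c q) (matA d a q) (matAs d a b⁻¹ c q) := by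
  have h1 := simConj_interchange h
  have h2 := simConj_interchange h.inv_middle
  obtain ⟨⟨ha, hb, hc, hq⟩, -⟩ := h
  have h3 := simConj_inv_left d hd (inv_ne_zero hb) (inv_ne_zero ha) hc hq
  exact (h1.trans h3.swap).trans h2.symm

lemma eq_or_eq_inv_of_add_inv_eq {x y : K} (hx : x ≠ 0) (hy : y ≠ 0)
    (h : x + x⁻¹ = y + y⁻¹) : x = y ∨ x = y⁻¹ := by
  have h0 : (x - y) * (x * y - 1) = 0 := by
    field_simp at h
    linear_combination h
  rcases mul_eq_zero.1 h0 with h | h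
  · exact Or.inl (sub_eq_zero.1 h)
  · exact Or.inr (eq_inv_of_mul_eq_one_left (sub_eq_zero.1 h))

lemma matAs_inv_right (d : ℕ) (a b c q : K) : matAs d a b c⁻¹ q = matAs d a b c q := by
  have : ∀ i, qφ d a b c⁻¹ q i = qφ d a b c q i := fun i => by
    simp only [qφ, inv_inv]
    ring
  simp only [matAs, this]

theorem simConj_of_add_inv_eq {d : ℕ} (hd : 1 ≤ d) {a b c a' b' c' q : K}
    (h : TQRACred d a b c q) (ha' : a' ≠ 0) (hb' : b' ≠ 0) (hc' : c' ≠ 0)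
    (ea : a' + a'⁻¹ = a + a⁻¹) (eb : b' + b'⁻¹ = b + b⁻¹) (ec : c' + c'⁻¹ = c + c⁻¹) :
    SimConj (matA d a q) (matAs d a b c q) (matA d a' q) (matAs d a' b' c' q) := by
  have hc1 : matAs d a' b' c' q = matAs d a' b' c q := by
    rcases eq_or_eq_inv_of_add_inv_eq hc' h.1.2.2.1 ec with rfl | rfl
    · rfl
    · rw [matAs_inv_right]
  have hb1 : SimConj (matA d a q) (matAs d a b c q) (matA d a q) (matAs d a b' c q) := by
    rcases eq_or_eq_inv_of_add_inv_eq hb' h.1.2.1 eb with rfl | rfl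
    · exact ⟨1, isUnit_one, by simp, by simp⟩
    · exact simConj_inv_middle hd h
  rw [hc1]
  refine hb1.trans ?_
  rcases eq_or_eq_inv_of_add_inv_eq ha' h.1.1 ea with rfl | rfl
  · exact ⟨1, isUnit_one, by simp, by simp⟩
  · exact simConj_inv_left d hd h.1.1 hb' h.1.2.2.1 h.1.2.2.2

lemma _root_.TQRACred.zθ_ne {d : ℕ} {a b c q : K} (h : TQRACred d a b c q) {i j : ℤ}
    (hi : 0 ≤ i) (hij : i < j) (hj : j ≤ d) : zθ d b q i ≠ zθ d b q j := by
  have hs := h.zpow_sub_ne (i := j - i) (by omega) (by omega)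
  obtain ⟨⟨ha, hb, hc, hq⟩, -, h3, -⟩ := h
  obtain ⟨-, hb2, -⟩ := h3 (i + j).toNat (by omega) (by omega)
  rw [Int.toNat_of_nonneg (by omega)] at hb2
  intro h0
  have hprod : (q ^ (j - i) - q ^ (-(j - i))) *
      (b * q ^ (i + j - d) - b⁻¹ * q ^ (-(i + j - d))) = 0 := by
    have e : ∀ x y z w : K, (x - y) * (b * z - b⁻¹ * w) =
        b * (x * z) - b * (y * z) - b⁻¹ * (x * w) + b⁻¹ * (y * w) := fun x y z w => by ring
    rw [e]
    simp only [← zpow_add₀ hq]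
    rw [show j - i + (i + j - d) = 2 * j - d by ring,
      show -(j - i) + (i + j - d) = 2 * i - d by ring,
      show j - i + -(i + j - d) = d - 2 * i by ring,
      show -(j - i) + -(i + j - d) = d - 2 * j by ring]
    simp only [zθ] at h0
    linear_combination -h0
  rcases mul_eq_zero.1 hprod with h | h
  · exact hs h
  · apply hb2
    have e : q ^ (2 * (d : ℤ) - 2 * (i + j)) = q ^ (-(i + j - d)) * q ^ (-(i + j - d)) := by
      rw [← zpow_add₀ hq]
      congr 1
      ring
    have e' : q ^ (i + j - d) * q ^ (-(i + j - d)) = 1 := by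
      rw [← zpow_add₀ hq, add_neg_cancel, zpow_zero]
    rw [e]
    generalize q ^ (i + j - d) = x at *
    generalize q ^ (-(i + j - d)) = y at *
    have e'' : b * b⁻¹ = 1 := mul_inv_cancel₀ hb
    linear_combination b * y * h - b ^ 2 * e' + y ^ 2 * e''

lemma _root_.TQRACred.eq_of_zθ_eq {d : ℕ} {a b c q : K} (h : TQRACred d a b c q) {i j : ℤ}
    (hi : 0 ≤ i) (hi' : i ≤ d) (hj : 0 ≤ j) (hj' : j ≤ d) (hij : zθ d b q i = zθ d b q j) :
    i = j := by
  rcases lt_trichotomy i j with hlt | heq | hgt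
  · exact absurd hij (h.zθ_ne hi hlt hj')
  · exact heq
  · exact absurd hij.symm (h.zθ_ne hj hgt hi')

/-- The first vector of a second split basis spans an eigenspace with index `j`, and its successor
in the new ordering is forced to be `j + 1` whenever `j < d`. -/
lemma exists_eigenvalue_index {d : ℕ} (hd : 1 ≤ d) {a b c a' b' c' q : K}
    (h : SimConj (matA d a q) (matAs d a b c q) (matA d a' q) (matAs d a' b' c' q)) :
    ∃ j : ℕ, j ≤ d ∧ zθ d b' q 0 = zθ d b q j ∧
      (j < d → zθ d b' q 1 = zθ d b q (j + 1)) ∧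
      (j = 0 → zφ d a b c q 1 - zφ d a' b' c' q 1 =
        (zθ d b' q 1 - zθ d b q 0) * (zθ d a q 0 - zθ d a' q 0)) := by
  obtain ⟨S, hS, hA, hB⟩ := h
  obtain ⟨w, hw⟩ : ∃ w, w = S.mulVec (basisVec K d 0) := ⟨_, rfl⟩
  obtain ⟨u, hu⟩ : ∃ u, u = S.mulVec (basisVec K d 1) := ⟨_, rfl⟩
  have hw0 : w ≠ 0 := by
    intro h0
    have hinj := Matrix.mulVec_injective_of_isUnit hS
    have := congrFun (hinj ((hw.symm.trans h0).trans (Matrix.mulVec_zero S).symm)) 0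
    simp [basisVec] at this
  have hBw : (matAs d a b c q).mulVec w = zθ d b' q 0 • w := by
    rw [hw, Matrix.mulVec_mulVec, hB, ← Matrix.mulVec_mulVec, matAs_mulVec_basisVec_zero,
      Matrix.mulVec_smul]
  have hAw : (matA d a q).mulVec w = zθ d a' q 0 • w + u := by
    rw [hw, hu, Matrix.mulVec_mulVec, hA, ← Matrix.mulVec_mulVec, matA_mulVec_basisVec,
      Matrix.mulVec_add, Matrix.mulVec_smul]
    simp
  have hBu : (matAs d a b c q).mulVec u = zθ d b' q 1 • u + zφ d a' b' c' q 1 • w := by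
    have := matAs_mulVec_basisVec_succ d a' b' c' q 0
    simp only [zero_add, Nat.cast_zero] at this
    rw [hw, hu, Matrix.mulVec_mulVec, hB, ← Matrix.mulVec_mulVec, this,
      Matrix.mulVec_add, Matrix.mulVec_smul, Matrix.mulVec_smul]
  have rowB : ∀ (x : Fin (d + 1) → K) (i : Fin (d + 1)), (matAs d a b c q).mulVec x i =
      opB d a b c q (extend d x) ((i : ℕ) : ℤ) := by
    intro x i
    conv_lhs => rw [← restr_extend d x]
    rw [matAs_mulVec_restr]
    rfl
  have rowA : ∀ (x : Fin (d + 1) → K) (i : Fin (d + 1)), (matA d a q).mulVec x i =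
      opA d a q (extend d x) ((i : ℕ) : ℤ) := by
    intro x i
    conv_lhs => rw [← restr_extend d x]
    rw [matA_mulVec_restr _ _ _ (extend_of_neg d x)]
    rfl
  have ext_coe : ∀ (x : Fin (d + 1) → K) (i : Fin (d + 1)), extend d x ((i : ℕ) : ℤ) = x i :=
    fun x i => congrFun (restr_extend d x) i
  classical
  have hne : (Finset.univ.filter fun i => w i ≠ 0).Nonempty := by
    obtain ⟨i, hi⟩ := Function.ne_iff.1 hw0
    exact ⟨i, by simpa using hi⟩
  obtain ⟨j, hj⟩ : ∃ j, j = (Finset.univ.filter fun i => w i ≠ 0).max' hne := ⟨_, rfl⟩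
  have hwj : w j ≠ 0 := by
    have := Finset.max'_mem _ hne
    rw [← hj] at this
    simpa using this
  have hgt : ∀ m : ℤ, ((j : ℕ) : ℤ) < m → extend d w m = 0 := by
    intro m hm
    rcases lt_or_ge (d : ℤ) m with h | h
    · exact extend_of_gt d w h
    · lift m to ℕ using by omega
      have e := ext_coe w ⟨m, by omega⟩
      simp only at e
      rw [e]
      by_contra h0
      have := Finset.le_max' (Finset.univ.filter fun i => w i ≠ 0) (⟨m, by omega⟩ : Fin (d + 1))
        (by simpa using h0)
      rw [← hj, Fin.le_def] at this
      simp only at this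
      omega
  have hjd := j.2
  have hu_row : ∀ m : ℤ, 0 ≤ m → m ≤ d → extend d u m =
      (zθ d a q m - zθ d a' q 0) * extend d w m + extend d w (m - 1) := by
    intro m hm hm'
    lift m to ℕ using hm
    have e := congrFun hAw ⟨m, by omega⟩
    rw [rowA] at e
    simp only [opA, Pi.add_apply, Pi.smul_apply, smul_eq_mul] at e
    rw [← ext_coe w, ← ext_coe u] at e
    simp only at e
    linear_combination -e
  have hu2 : ∀ m : ℤ, ((j : ℕ) : ℤ) + 1 < m → extend d u m = 0 := by
    intro m hm
    rcases lt_or_ge (d : ℤ) m with h | h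
    · exact extend_of_gt d u h
    · rw [hu_row m (by omega) h, hgt m (by omega), hgt (m - 1) (by omega)]
      ring
  have h0 : zθ d b' q 0 = zθ d b q (j : ℕ) := by
    have e := congrFun hBw j
    rw [rowB] at e
    simp only [opB, Pi.smul_apply, smul_eq_mul, hgt (((j : ℕ) : ℤ) + 1) (by omega), mul_zero,
      add_zero, ext_coe] at e
    exact (mul_right_cancel₀ hwj e).symm
  have hu_succ : ((j : ℕ) < d) → extend d u ((j : ℕ) + 1) = w j := by
    intro hjd'
    rw [hu_row _ (by omega) (by omega), hgt _ (by omega), add_sub_cancel_right, ext_coe]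
    ring
  refine ⟨j, by omega, h0, fun hjd' => ?_, fun hj0 => ?_⟩
  · have e := congrFun hBu ⟨j + 1, by omega⟩
    rw [rowB] at e
    simp only [opB, Pi.add_apply, Pi.smul_apply, smul_eq_mul] at e
    rw [← ext_coe w, ← ext_coe u] at e
    simp only at e
    push_cast at e
    rw [hu_succ hjd', hu2 _ (by omega), hgt _ (by omega), mul_zero, mul_zero, add_zero,
      add_zero] at e
    exact (mul_right_cancel₀ hwj e).symm
  · have e := congrFun hBu j
    have hu1 := hu_succ (by omega)
    have hu0 := hu_row (j : ℕ) (by omega) (by omega)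
    rw [rowB] at e
    simp only [opB, Pi.add_apply, Pi.smul_apply, smul_eq_mul] at e
    rw [extend_of_neg d w (((j : ℕ) : ℤ) - 1) (by omega), add_zero] at hu0
    rw [← ext_coe u j, hu1, hu0, ext_coe] at e
    simp only [hj0, Nat.cast_zero, zero_add] at e
    refine mul_right_cancel₀ hwj ?_
    linear_combination e

lemma eq_of_zθ_zero_one {d : ℕ} {b b' q : K} (hq : q ≠ 0) (hq4 : q ^ 4 ≠ 1)
    (h0 : zθ d b' q 0 = zθ d b q 0) (h1 : zθ d b' q 1 = zθ d b q 1) : b' = b := by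
  simp only [zθ, zpow_sub₀ hq, mul_zero, sub_zero, mul_one, zpow_natCast,
    zpow_ofNat] at h0 h1
  have hD : q ^ d ≠ 0 := pow_ne_zero _ hq
  generalize q ^ d = D at *
  generalize b⁻¹ = β at *
  generalize b'⁻¹ = β' at *
  field_simp at h0 h1
  have : (b' - b) * (q ^ 4 - 1) = 0 := by linear_combination h1 - h0
  exact sub_eq_zero.1 ((mul_eq_zero.1 this).resolve_right (sub_ne_zero.2 hq4))

lemma dual_eq_or_eq_inv {d : ℕ} (hd : 2 ≤ d) {a b c a' b' c' q : K} (h : TQRACred d a b c q)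
    (hs : SimConj (matA d a q) (matAs d a b c q) (matA d a' q) (matAs d a' b' c' q)) :
    b' = b ∨ b' = b⁻¹ := by
  have hq4 : q ^ 4 ≠ 1 := h.2.1 2 (by omega) hd
  have hq : q ≠ 0 := h.1.2.2.2
  obtain ⟨j, hj, e0, e1, -⟩ := exists_eigenvalue_index (by omega) hs
  obtain ⟨k, hk, f0, f1, -⟩ := exists_eigenvalue_index (by omega)
    ((simConj_inv_middle (by omega) h).symm.trans hs)
  have hjk : (j : ℤ) = d - k := by
    refine h.eq_of_zθ_eq (by omega) (by omega) (by omega) (by omega) ?_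
    rw [← e0, f0, zθ_inv]
  rcases Nat.eq_zero_or_pos j with hj0 | hj0
  · subst hj0
    exact Or.inl (eq_of_zθ_zero_one hq hq4 (by simpa using e0) (by simpa using e1 (by omega)))
  rcases Nat.eq_zero_or_pos k with hk0 | hk0
  · subst hk0
    exact Or.inr (eq_of_zθ_zero_one hq hq4 (by simpa using f0) (by simpa using f1 (by omega)))
  have := h.eq_of_zθ_eq (i := j + 1) (j := d - (k + 1)) (by omega) (by omega) (by omega)
    (by omega) (by rw [← e1 (by omega), f1 (by omega), zθ_inv])
  omega

lemma add_inv_eq_of_eq_or_eq_inv {x y : K} (h : x = y ∨ x = y⁻¹) : x + x⁻¹ = y + y⁻¹ := by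
  rcases h with rfl | rfl
  · rfl
  · rw [inv_inv, add_comm]

lemma third_add_inv_eq {d : ℕ} (hd : 2 ≤ d) {a b c c' q : K} (h : TQRACred d a b c q)
    (hs : SimConj (matA d a q) (matAs d a b c q) (matA d a q) (matAs d a b c' q))
    (hc' : c' ≠ 0) : c' + c'⁻¹ = c + c⁻¹ := by
  obtain ⟨j, hj, e0, -, e2⟩ := exists_eigenvalue_index (by omega) hs
  have hj0 : (0 : ℤ) = j := h.eq_of_zθ_eq le_rfl (by omega) (by omega) (by omega) e0
  have hφ := e2 (by omega)
  have hs1 := h.zpow_sub_ne (i := 1) le_rfl (by omega)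
  have hs2 := h.zpow_sub_ne (i := d) (by omega) le_rfl
  obtain ⟨⟨ha, hb, hc, hq⟩, -⟩ := h
  have hD : q ^ d ≠ 0 := pow_ne_zero _ hq
  have hfac : (q ^ (1 : ℤ) - q ^ (-1 : ℤ)) * (q ^ (d : ℤ) - q ^ (-(d : ℤ))) *
      ((c' + c'⁻¹) - (c + c⁻¹)) = 0 := by
    rw [sub_self, mul_zero] at hφ
    simp only [zφ, zpow_add₀ hq, zpow_sub₀ hq, zpow_neg, zpow_natCast, zpow_one] at hφ ⊢
    generalize q ^ d = D at *
    field_simp at hφ ⊢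
    refine mul_left_cancel₀ (mul_ne_zero (mul_ne_zero (mul_ne_zero ha hb) hq) hD) ?_
    linear_combination -hφ
  exact sub_eq_zero.1 ((mul_eq_zero.1 hfac).resolve_left (mul_ne_zero hs1 hs2))

theorem add_inv_eq_of_simConj {d : ℕ} (hd : 2 ≤ d) {a b c a' b' c' q : K}
    (h : TQRACred d a b c q) (h' : TQRACred d a' b' c' q)
    (hs : SimConj (matA d a q) (matAs d a b c q) (matA d a' q) (matAs d a' b' c' q)) :
    a' + a'⁻¹ = a + a⁻¹ ∧ b' + b'⁻¹ = b + b⁻¹ ∧ c' + c'⁻¹ = c + c⁻¹ := by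
  have eb := add_inv_eq_of_eq_or_eq_inv (dual_eq_or_eq_inv hd h hs)
  have ea : a' + a'⁻¹ = a + a⁻¹ := by
    have hs' := ((simConj_interchange h).symm.trans (hs.trans (simConj_interchange h'))).swap
    have := add_inv_eq_of_eq_or_eq_inv
      (dual_eq_or_eq_inv hd h.swap.inv_left.inv_middle hs')
    simpa [add_comm] using this
  refine ⟨ea, eb, ?_⟩
  refine third_add_inv_eq hd h (hs.trans ?_) h'.1.2.2.1
  exact simConj_of_add_inv_eq (by omega) h' h.1.1 h.1.2.1 h'.1.2.2.1 ea.symm eb.symm rfl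

lemma _root_.TQRACred.sq_sub_inv_ne {d : ℕ} (hd : 2 ≤ d) {a b c q : K}
    (h : TQRACred d a b c q) : q ^ 2 - q ^ (-2 : ℤ) ≠ 0 :=
  by simpa using h.zpow_sub_ne (i := 2) (by omega) (by omega)

/-- The base is determined by any expression of the third matrix as a combination of `A * A*`,
`A* * A` and the identity. -/
lemma base_eq {d : ℕ} (hd : 2 ≤ d) {a b c q p γ γ' : K} (h : TQRACred d a b c p) (hq : q ≠ 0)
    (hq2 : q ^ 2 - q ^ (-2 : ℤ) ≠ 0)
    (e : (q ^ 2 - q ^ (-2 : ℤ))⁻¹ •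
      (q⁻¹ • (matAs d a b c p * matA d a p) - q • (matA d a p * matAs d a b c p)) + γ • 1 =
      (p ^ 2 - p ^ (-2 : ℤ))⁻¹ •
      (p⁻¹ • (matAs d a b c p * matA d a p) - p • (matA d a p * matAs d a b c p)) + γ' • 1) :
    p = q := by
  have hp2 := h.sq_sub_inv_ne hd
  obtain ⟨⟨ha, hb, hc, hp⟩, -⟩ := h
  have row0 := congrFun (congrArg (·.mulVec (basisVec K d 0)) e) ⟨1, by omega⟩
  have row1 := congrFun (congrArg (·.mulVec (basisVec K d 1)) e) ⟨2, by omega⟩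
  have hB1 := matAs_mulVec_basisVec_succ d a b c p 0
  have hB2 := matAs_mulVec_basisVec_succ d a b c p 1
  simp only [zero_add, Nat.cast_zero, Nat.cast_one, Nat.reduceAdd] at hB1 hB2
  simp only [Matrix.add_mulVec, Matrix.sub_mulVec, Matrix.smul_mulVec, Matrix.one_mulVec,
    ← Matrix.mulVec_mulVec, matA_mulVec_basisVec, matAs_mulVec_basisVec_zero, hB1, hB2,
    Matrix.mulVec_add, Matrix.mulVec_smul, zero_add, Nat.reduceAdd] at row0 row1
  simp [basisVec] at row0 row1
  have hP : p ^ (-2 : ℤ) = (p ^ 2)⁻¹ := by simp [zpow_neg]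
  have hQ : q ^ (-2 : ℤ) = (q ^ 2)⁻¹ := by simp [zpow_neg]
  rw [hP] at hp2
  rw [hQ] at hq2
  obtain ⟨s, hs⟩ : ∃ s, s = (q ^ 2 - (q ^ 2)⁻¹)⁻¹ := ⟨_, rfl⟩
  obtain ⟨t, ht⟩ : ∃ t, t = (p ^ 2 - (p ^ 2)⁻¹)⁻¹ := ⟨_, rfl⟩
  have hs0 : s ≠ 0 := hs ▸ inv_ne_zero hq2
  rw [← hs, ← ht] at row0 row1
  have hD : p ^ d ≠ 0 := pow_ne_zero _ hp
  have z0 : zθ d b p 0 = b * (p ^ d)⁻¹ + b⁻¹ * p ^ d := by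
    simp [zθ, zpow_neg]
  have z1 : zθ d b p 1 = b * (p ^ d)⁻¹ * p ^ 2 + b⁻¹ * p ^ d * (p ^ 2)⁻¹ := by
    simp only [zθ, zpow_sub₀ hp, mul_one, zpow_natCast, zpow_ofNat]
    ring
  have z2 : zθ d b p 2 = b * (p ^ d)⁻¹ * (p ^ 2) ^ 2 + b⁻¹ * p ^ d * (p ^ 2)⁻¹ ^ 2 := by
    simp only [zθ, zpow_sub₀ hp, show (2 * 2 : ℤ) = 4 by norm_num, zpow_natCast, zpow_ofNat]
    ring
  rw [z0, z1] at row0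
  rw [z1, z2] at row1
  have hβ : b * (p ^ d)⁻¹ ≠ 0 := mul_ne_zero hb (inv_ne_zero hD)
  have hδ : b⁻¹ * p ^ d ≠ 0 := mul_ne_zero (inv_ne_zero hb) hD
  generalize b * (p ^ d)⁻¹ = β at *
  generalize b⁻¹ * p ^ d = δ at *
  obtain ⟨x, hx⟩ : ∃ x, x = s * q⁻¹ - t * p⁻¹ := ⟨_, rfl⟩
  obtain ⟨y, hy⟩ : ∃ y, y = t * p - s * q := ⟨_, rfl⟩
  have h1 : x * (p ^ 2)⁻¹ + y = 0 := by
    refine (mul_eq_zero.1 ?_).resolve_left (mul_ne_zero hδ hp2)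
    rw [hx, hy]
    linear_combination p ^ 2 * row0 - row1
  have h2 : x * p ^ 2 + y = 0 := by
    refine (mul_eq_zero.1 ?_).resolve_left (mul_ne_zero hβ hp2)
    rw [hx, hy]
    linear_combination row1 - (p ^ 2)⁻¹ * row0
  have hx0 : x = 0 :=
    (mul_eq_zero.1 (show x * (p ^ 2 - (p ^ 2)⁻¹) = 0 by linear_combination h2 - h1)).resolve_right
      hp2
  have hy0 : y = 0 := by simpa [hx0] using h2
  rw [hx0] at hx
  rw [hy0] at hy
  have hsq : s * (p ^ 2 - q ^ 2) = 0 := by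
    field_simp at hx
    linear_combination -p * hx - q * hy
  have hpq : p ^ 2 = q ^ 2 := sub_eq_zero.1 ((mul_eq_zero.1 hsq).resolve_left hs0)
  rw [hpq, ← hs] at ht
  rw [ht] at hy
  exact sub_eq_zero.1 ((mul_eq_zero.1 (show s * (p - q) = 0 by linear_combination -hy)).resolve_left
    hs0)

lemma matAe_eq (d : ℕ) (a b c q : K) : matAe d a b c q = (q ^ 2 - q ^ (-2 : ℤ))⁻¹ •
    (q⁻¹ • (matAs d a b c q * matA d a q) - q • (matA d a q * matAs d a b c q)) +
      (central d a b c q / (q + q⁻¹)) • 1 := rfl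

lemma inv_conj_eq_iff {n : ℕ} {S A A' : Matrix (Fin n) (Fin n) K} (hS : IsUnit S) :
    S⁻¹ * A * S = A' ↔ A * S = S * A' := by
  have hdet := (Matrix.isUnit_iff_isUnit_det S).1 hS
  constructor
  · rintro rfl
    rw [mul_assoc, Matrix.mul_nonsing_inv_cancel_left _ _ hdet]
  · intro h
    rw [mul_assoc, h, Matrix.nonsing_inv_mul_cancel_left _ _ hdet]

lemma combination_mul {n : ℕ} {S A B A' B' : Matrix (Fin n) (Fin n) K} (hA : A * S = S * A')
    (hB : B * S = S * B') (s x y z : K) :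
    (s • (x • (B * A) - y • (A * B)) + z • 1) * S =
      S * (s • (x • (B' * A') - y • (A' * B')) + z • 1) := by
  have h1 : B * A * S = S * (B' * A') := by
    rw [mul_assoc, hA, ← mul_assoc, hB, mul_assoc]
  have h2 : A * B * S = S * (A' * B') := by
    rw [mul_assoc, hB, ← mul_assoc, hA, mul_assoc]
  simp only [add_mul, sub_mul, mul_add, mul_sub, Matrix.smul_mul, Matrix.mul_smul, h1, h2,
    one_mul, mul_one]

end QRacah

/-- Theorem 16.2 + 16.6: two Leonard triples of QRacah type associated with elements
of T-QRAC_red are isomorphic (conjugate by an invertible matrix) iff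
q′ = q, a′+a′⁻¹ = a+a⁻¹, b′+b′⁻¹ = b+b⁻¹ and c′+c′⁻¹ = c+c⁻¹. -/
theorem stmt_19 {K : Type*} [Field K] [IsAlgClosed K] (d : ℕ) (hd : 3 ≤ d)
    (a b c q a' b' c' q' : K)
    (h : TQRACred d a b c q) (h' : TQRACred d a' b' c' q') :
    (∃ S : Matrix (Fin (d + 1)) (Fin (d + 1)) K, IsUnit S ∧
        S⁻¹ * matA d a q * S = matA d a' q' ∧
        S⁻¹ * matAs d a b c q * S = matAs d a' b' c' q' ∧
        S⁻¹ * matAe d a b c q * S = matAe d a' b' c' q') ↔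
    (q' = q ∧ a' + a'⁻¹ = a + a⁻¹ ∧ b' + b'⁻¹ = b + b⁻¹ ∧ c' + c'⁻¹ = c + c⁻¹) := by
  constructor
  · rintro ⟨S, hS, hA, hB, hE⟩
    rw [QRacah.inv_conj_eq_iff hS] at hA hB hE
    have hq : q' = q := by
      refine QRacah.base_eq (by omega) h' h.1.2.2.2 (h.sq_sub_inv_ne (by omega))
        (γ := QRacah.central d a b c q / (q + q⁻¹))
        (γ' := QRacah.central d a' b' c' q' / (q' + q'⁻¹)) ?_
      rw [QRacah.matAe_eq, QRacah.combination_mul hA hB] at hE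
      exact (hS.mul_left_cancel hE).trans (QRacah.matAe_eq ..)
    subst hq
    exact ⟨rfl, QRacah.add_inv_eq_of_simConj (by omega) h h' ⟨S, hS, hA, hB⟩⟩
  · rintro ⟨rfl, ea, eb, ec⟩
    obtain ⟨S, hS, hA, hB⟩ := QRacah.simConj_of_add_inv_eq (by omega) h h'.1.1 h'.1.2.1
      h'.1.2.2.1 ea eb ec
    refine ⟨S, hS, (QRacah.inv_conj_eq_iff hS).2 hA, (QRacah.inv_conj_eq_iff hS).2 hB,
      (QRacah.inv_conj_eq_iff hS).2 ?_⟩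
    rw [QRacah.matAe_eq, QRacah.combination_mul hA hB, QRacah.matAe_eq, QRacah.central,
      QRacah.central, ea, eb, ec]
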